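/- If L ⊆ V ⊕ εV is a Lagrangian K[ε]-submodule and F = π(L), then F is an isotropic subspace of V (i.e. b₁ vanishes on F × F) and L ∩ εV = εF^⊥, where F^⊥ = {v ∈ V : b₁(v, f) = 0 for all f ∈ F}. -/

import Mathlib

/-!
STATEMENT 9: If `L ⊆ V ⊕ εV` is a Lagrangian `K[ε]`-submodule and `F = π(L)`, then `F` is
an isotropic subspace of `V` and `L ∩ εV = εF^⊥`, where
`F^⊥ = {v ∈ V : b₁(v, f) = 0 for all f ∈ F}`.

We model `V ⊕ εV` as `V × V`, `(a, b) ↔ a + ε b`, with `ε`-action `eps : (a,b) ↦ (0,a)`,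
`π` the first projection, `εV = ker π`; `b₂` is the `K[ε]`-bilinear extension of `b₁`, with
values in `K[ε] = K × K`:  `b₂ (a,b) (a',b') = (b₁ a a', b₁ a b' + b₁ b a')`.  `L` is
Lagrangian iff `b₂` vanishes on `L × L` and `dim_K L = r = dim_K V`.
-/

/-- Multiplication by `ε` on `V ⊕ εV ≅ V × V`: `(a, b) ↦ (0, a)`. -/
noncomputable abbrev eps (K V : Type*) [Field K] [AddCommGroup V] [Module K V] :
    V × V →ₗ[K] V × V :=
  (LinearMap.inr K V V) ∘ₗ (LinearMap.fst K V V)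

/-- The `K[ε]`-bilinear extension `b₂` of a bilinear form `b₁` on `V` to `V ⊕ εV`. -/
noncomputable def b2 {K V : Type*} [Field K] [AddCommGroup V] [Module K V]
    (b₁ : V →ₗ[K] V →ₗ[K] K) : (V × V) →ₗ[K] (V × V) →ₗ[K] K × K :=
  LinearMap.mk₂ K (fun x y => (b₁ x.1 y.1, b₁ x.1 y.2 + b₁ x.2 y.1))
    (fun m m' n => by simp [Prod.ext_iff]; ring)
    (fun c m n => by simp [Prod.ext_iff]; ring)
    (fun m n n' => by simp [Prod.ext_iff]; ring)
    (fun c m n => by simp [Prod.ext_iff]; ring)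

/-- The orthogonal complement `F^⊥ = {v ∈ V : b₁(v, f) = 0 ∀ f ∈ F}`. -/
def perp {K V : Type*} [Field K] [AddCommGroup V] [Module K V]
    (b₁ : V →ₗ[K] V →ₗ[K] K) (F : Submodule K V) : Submodule K V where
  carrier := {v | ∀ f ∈ F, b₁ v f = 0}
  add_mem' := by
    intro a b ha hb f hf
    simp [ha f hf, hb f hf]
  zero_mem' := by
    intro f hf
    simp
  smul_mem' := by
    intro c a ha f hf
    simp [ha f hf]

/-- The kernel of `f` on a subspace and the image of that subspace have complementary dimension. -/
theorem Submodule.finrank_map_add_finrank_inf_ker {K V W : Type*} [Field K]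
    [AddCommGroup V] [Module K V] [FiniteDimensional K V] [AddCommGroup W] [Module K W]
    (f : V →ₗ[K] W) (L : Submodule K V) :
    Module.finrank K (L.map f) + Module.finrank K (L ⊓ LinearMap.ker f : Submodule K V) =
      Module.finrank K L := by
  have h := (f.domRestrict L).finrank_range_add_finrank_ker
  rwa [LinearMap.range_domRestrict, LinearMap.ker_domRestrict,
    ← Submodule.finrank_map_subtype_eq L, Submodule.map_comap_subtype] at h

theorem perp_eq_orthogonal {K V : Type*} [Field K] [AddCommGroup V] [Module K V]
    {b₁ : V →ₗ[K] V →ₗ[K] K} (hsymm : ∀ v w : V, b₁ v w = b₁ w v) (F : Submodule K V) :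
    perp b₁ F = LinearMap.BilinForm.orthogonal b₁ F := by
  ext v
  exact forall₂_congr fun f _ => by rw [hsymm v f]

theorem finrank_add_finrank_perp {K V : Type*} [Field K] [AddCommGroup V] [Module K V]
    [FiniteDimensional K V] {b₁ : V →ₗ[K] V →ₗ[K] K} (hsymm : ∀ v w : V, b₁ v w = b₁ w v)
    (hnd : ∀ v : V, (∀ w : V, b₁ v w = 0) → v = 0) (F : Submodule K V) :
    Module.finrank K F + Module.finrank K (perp b₁ F) = Module.finrank K V := by
  have hb : b₁.Nondegenerate :=
    ⟨hnd, fun v hv => hnd v fun w => (hsymm v w).trans (hv w)⟩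
  rw [perp_eq_orthogonal hsymm, LinearMap.BilinForm.finrank_orthogonal hb]
  have := F.finrank_le
  lia

theorem stmt9 {K V : Type*} [Field K] [AddCommGroup V] [Module K V] [FiniteDimensional K V]
    (hchar : (2 : K) ≠ 0)
    (b₁ : V →ₗ[K] V →ₗ[K] K)
    (hsymm : ∀ v w : V, b₁ v w = b₁ w v)
    (hnd : ∀ v : V, (∀ w : V, b₁ v w = 0) → v = 0)
    (L : Submodule K (V × V)) (hL : ∀ x ∈ L, eps K V x ∈ L)
    (hiso : ∀ x ∈ L, ∀ y ∈ L, b2 b₁ x y = 0)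
    (hdim : Module.finrank K L = Module.finrank K V)
    (F : Submodule K V) (hF : F = L.map (LinearMap.fst K V V)) :
    -- F is isotropic
    (∀ a ∈ F, ∀ a' ∈ F, b₁ a a' = 0)
    -- L ∩ εV = ε F^⊥
    ∧ L ⊓ LinearMap.ker (LinearMap.fst K V V) = (perp b₁ F).map (LinearMap.inr K V V) := by
  subst hF
  refine ⟨?_, Submodule.eq_of_le_of_finrank_le ?_ ?_⟩
  · rintro _ ⟨x, hx, rfl⟩ _ ⟨y, hy, rfl⟩
    exact congrArg Prod.fst (hiso x hx y hy)
  · rintro ⟨a, v⟩ ⟨hx, ha⟩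
    obtain rfl : a = 0 := ha
    refine ⟨v, ?_, rfl⟩
    rintro _ ⟨y, hy, rfl⟩
    simpa [b2] using congrArg Prod.snd (hiso _ hx y hy)
  · have hmap := Submodule.finrank_map_le (LinearMap.inr K V V)
      (perp b₁ (L.map (LinearMap.fst K V V)))
    have hperp := finrank_add_finrank_perp hsymm hnd (L.map (LinearMap.fst K V V))
    have hker := L.finrank_map_add_finrank_inf_ker (LinearMap.fst K V V)
    lia
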